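/- Let d > 0, θ₋, θ₊ ∈ (-1,1), T > 0, and let u : [-d,d] × [0,T] → ℝ be smooth with |u_x| < 1, satisfying u_t = u_{xx}/(1 - u_x²) on [-d,d]×[0,T] and u_x(-d,t) = θ₋, u_x(d,t) = θ₊ for all t ∈ [0,T]. Assume the initial curve is spacelike: sup_{y ∈ [-d,d]} |u_x(y,0)| < 1. Then for all x ∈ [-d,d] and all t ∈ [0,T], |u_x(x,t)| ≤ sup_{y ∈ [-d,d]} |u_x(y,0)| < 1. -/

import Mathlib

/-- First spatial partial derivative `u_x`. -/
noncomputable def ux (u : ℝ → ℝ → ℝ) (x t : ℝ) : ℝ := deriv (fun y => u y t) x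

/-- Second spatial partial derivative `u_{xx}`. -/
noncomputable def uxx (u : ℝ → ℝ → ℝ) (x t : ℝ) : ℝ := deriv (fun y => ux u y t) x

/-- Time partial derivative `u_t`. -/
noncomputable def ut (u : ℝ → ℝ → ℝ) (x t : ℝ) : ℝ := deriv (fun s => u x s) t

/-- One-sided first-order condition at a maximum over a segment. -/
theorem mul_nonpos_of_isMaxOn_Icc {f : ℝ → ℝ} {f' a b x y : ℝ}
    (hmax : ∀ z ∈ Set.Icc a b, f z ≤ f x) (hf : HasDerivWithinAt f f' (Set.Icc a b) x)
    (hx : x ∈ Set.Icc a b) (hy : y ∈ Set.Icc a b) : (y - x) * f' ≤ 0 := by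
  have hloc : IsLocalMaxOn f (Set.Icc a b) x := IsMaxOn.localize hmax
  have hcone : y - x ∈ posTangentConeAt (Set.Icc a b) x :=
    sub_mem_posTangentConeAt_of_segment_subset ((convex_Icc a b).segment_subset hx hy)
  simpa [mul_comm] using hloc.hasFDerivWithinAt_nonpos hf.hasFDerivWithinAt hcone

/-- Second-order necessary condition at an interior local maximum. -/
theorem IsLocalMax.second_deriv_nonpos {f f' : ℝ → ℝ} {f'' x : ℝ} (hmax : IsLocalMax f x)
    (hf : ∀ᶠ y in nhds x, HasDerivAt f (f' y) y) (hf' : HasDerivAt f' f'' x) : f'' ≤ 0 := by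
  by_contra! hpos
  have hderiv : deriv f =ᶠ[nhds x] f' := hf.mono fun y hy => hy.deriv
  have hmin : IsLocalMin f x :=
    isLocalMin_of_deriv_deriv_pos (by rw [hderiv.deriv_eq, hf'.deriv]; exact hpos)
      hmax.deriv_eq_zero hf.self_of_nhds.continuousAt
  have hconst : f =ᶠ[nhds x] fun _ => f x := by
    filter_upwards [hmax, hmin] with y h₁ h₂ using le_antisymm h₁ h₂
  have hzero : deriv (deriv f) x = 0 := by
    have h := hconst.deriv.deriv_eq
    simpa using h
  rw [hderiv.deriv_eq, hf'.deriv] at hzero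
  exact hpos.ne' hzero

/-- At the first time at which a continuous function on a space-time rectangle reaches
the level `m`, its spatial maximum is attained and equals `m`. -/
theorem exists_first_touching {a b t₁ m x₁ : ℝ} {w : ℝ → ℝ → ℝ}
    (hw : ContinuousOn (fun p : ℝ × ℝ => w p.1 p.2) (Set.Icc a b ×ˢ Set.Icc 0 t₁))
    (ht₁ : 0 ≤ t₁) (hx₁ : x₁ ∈ Set.Icc a b) (h₁ : m ≤ w x₁ t₁)
    (hinit : ∀ x ∈ Set.Icc a b, w x 0 < m) :
    ∃ x₀ ∈ Set.Icc a b, ∃ t₀ ∈ Set.Ioc 0 t₁, w x₀ t₀ = m ∧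
      (∀ x ∈ Set.Icc a b, w x t₀ ≤ m) ∧ ∀ t ∈ Set.Icc 0 t₀, w x₀ t ≤ m := by
  have hclosed : IsClosed ((Set.Icc a b ×ˢ Set.Icc 0 t₁) ∩
      (fun p : ℝ × ℝ => w p.1 p.2) ⁻¹' Set.Ici m) :=
    hw.preimage_isClosed_of_isClosed (isClosed_Icc.prod isClosed_Icc) isClosed_Ici
  have hcompact := (isCompact_Icc.prod isCompact_Icc).of_isClosed_subset hclosed
    Set.inter_subset_left
  obtain ⟨⟨x₀, t₀⟩, ⟨⟨hx₀, ht₀⟩, hm₀⟩, hmin⟩ := hcompact.exists_isMinOn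
    ⟨(x₁, t₁), ⟨hx₁, ⟨ht₁, le_rfl⟩⟩, h₁⟩ continuous_snd.continuousOn
  simp only [Set.mem_preimage, Set.mem_Ici] at hx₀ ht₀ hm₀
  have hpos : 0 < t₀ := by
    rcases ht₀.1.eq_or_lt with h | h
    · subst h
      exact absurd hm₀ (hinit x₀ hx₀).not_ge
    · exact h
  have hbefore : ∀ x ∈ Set.Icc a b, ∀ t ∈ Set.Ico 0 t₀, w x t < m := by
    intro x hx t ht
    by_contra! hge
    have : t₀ ≤ t := hmin (a := (x, t)) ⟨⟨hx, ht.1, ht.2.le.trans ht₀.2⟩, hge⟩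
    exact absurd ht.2 this.not_gt
  have hat : ∀ x ∈ Set.Icc a b, w x t₀ ≤ m := by
    intro x hx
    have hc : ContinuousWithinAt (fun t => w x t) (Set.Ico 0 t₀) t₀ := by
      have := (hw (x, t₀) ⟨hx, ht₀⟩).comp (f := fun t : ℝ => (x, t)) (s := Set.Ico 0 t₀)
        (by fun_prop) (fun t ht => ⟨hx, ht.1, ht.2.le.trans ht₀.2⟩)
      exact this
    have : (nhdsWithin t₀ (Set.Ico 0 t₀)).NeBot := by
      rw [← mem_closure_iff_nhdsWithin_neBot, closure_Ico hpos.ne]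
      exact ⟨hpos.le, le_rfl⟩
    exact le_of_tendsto hc (eventually_mem_nhdsWithin.mono fun t ht => (hbefore x hx t ht).le)
  refine ⟨x₀, hx₀, t₀, ⟨hpos, ht₀.2⟩, le_antisymm (hat x₀ hx₀) hm₀, hat, fun t ht => ?_⟩
  rcases ht.2.eq_or_lt with h | h
  · exact h ▸ hat x₀ hx₀
  · exact (hbefore x₀ hx₀ t ⟨ht.1, h⟩).le

/-- Maximum principle for `v_t = v_xx / (1 - v²) + 2 v v_x² / (1 - v²)²`, the equation satisfied
by the slope of the flow. At each lateral boundary point either the bound holds or the normal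
derivative vanishes. -/
theorem slope_le_of_initial_le {d T M : ℝ} {v : ℝ → ℝ → ℝ} (hd : 0 < d)
    (hM₀ : 0 ≤ M) (hM₁ : M < 1)
    (hv : ContinuousOn (fun p : ℝ × ℝ => v p.1 p.2) (Set.Icc (-d) d ×ˢ Set.Icc 0 T))
    (hinit : ∀ x ∈ Set.Icc (-d) d, v x 0 ≤ M)
    (hpde : ∀ x ∈ Set.Ioo (-d) d, ∀ t ∈ Set.Ioo 0 T, ∃ (a : ℝ → ℝ) (b c : ℝ),
      HasDerivAt (fun s => v x s) c t ∧ (∀ᶠ y in nhds x, HasDerivAt (fun z => v z t) (a y) y) ∧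
      HasDerivAt a b x ∧
      c = b / (1 - v x t ^ 2) + 2 * v x t * a x ^ 2 / (1 - v x t ^ 2) ^ 2)
    (hbc : ∀ x, x = -d ∨ x = d → ∀ t ∈ Set.Ioo 0 T, v x t ≤ M ∨
      HasDerivWithinAt (fun y => v y t) 0 (Set.Icc (-d) d) x) :
    ∀ x ∈ Set.Icc (-d) d, ∀ t ∈ Set.Ico 0 T, v x t ≤ M := by
  intro x₁ hx₁ t₁ ht₁
  by_contra! hgt
  have hT : 0 < T := ht₁.1.trans_lt ht₁.2
  obtain ⟨m, hMm, hm⟩ := exists_between (lt_min hgt hM₁)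
  obtain ⟨hmv, hm₁⟩ := lt_min_iff.1 hm
  obtain ⟨κ, hκ⟩ : ∃ κ, κ = 1 - ((1 + m) / 2) ^ 2 := ⟨_, rfl⟩
  have hκ₀ : 0 < κ := by rw [hκ]; nlinarith
  obtain ⟨C, hC⟩ : ∃ C, C = 2 / κ + 8 * d ^ 2 / κ ^ 2 + 1 := ⟨_, rfl⟩
  have hC₀ : 0 < C := by rw [hC]; positivity
  obtain ⟨ε, hε, hεlt⟩ := exists_pos_mul_lt
    (lt_min (show 0 < (1 - m) / 2 by linarith) (sub_pos.2 hmv)) (d ^ 2 + C * T + 1)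
  obtain ⟨hε₁, hε₂⟩ := lt_min_iff.1 hεlt
  have hsq : ∀ x ∈ Set.Icc (-d) d, x ^ 2 ≤ d ^ 2 := fun x hx => sq_le_sq' hx.1 hx.2
  have hpert : ∀ x ∈ Set.Icc (-d) d, ∀ t ∈ Set.Icc 0 T,
      ε * (x ^ 2 + C * t) ≤ (d ^ 2 + C * T + 1) * ε := by
    intro x hx t ht
    rw [mul_comm ε]
    refine mul_le_mul_of_nonneg_right ?_ hε.le
    linarith [hsq x hx, mul_le_mul_of_nonneg_left ht.2 hC₀.le]
  have hεone : ε ≤ 1 := by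
    have : 0 ≤ (d ^ 2 + C * T) * ε := by positivity
    linarith
  obtain ⟨x₀, hx₀, t₀, ht₀, heq, hmaxx, hmaxt⟩ := exists_first_touching (m := m) (t₁ := t₁)
    (w := fun x t => v x t - ε * (x ^ 2 + C * t))
    ((hv.mono (Set.prod_mono_right (Set.Icc_subset_Icc_right ht₁.2.le))).sub (by fun_prop))
    ht₁.1 hx₁ (by linarith [hpert x₁ hx₁ t₁ ⟨ht₁.1, ht₁.2.le⟩])
    (fun x hx => by nlinarith [hinit x hx, mul_nonneg hε.le (sq_nonneg x)])
  have ht₀T : t₀ ∈ Set.Ioo 0 T := ⟨ht₀.1, ht₀.2.trans_lt ht₁.2⟩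
  have hP₀ : 0 ≤ ε * (x₀ ^ 2 + C * t₀) := by
    have := ht₀.1.le
    positivity
  have hvm : m ≤ v x₀ t₀ := by linarith
  have hvlt : v x₀ t₀ ≤ (1 + m) / 2 := by
    linarith [hpert x₀ hx₀ t₀ ⟨ht₀.1.le, ht₀T.2.le⟩]
  have hbdry : ∀ x, x = -d ∨ x = d → x ≠ x₀ := by
    rintro x hx rfl
    rcases hbc x hx t₀ ht₀T with h | h
    · linarith
    · have hw : HasDerivWithinAt (fun y => v y t₀ - ε * (y ^ 2 + C * t₀)) (0 - ε * (2 * x))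
          (Set.Icc (-d) d) x := by
        refine h.sub (HasDerivAt.hasDerivWithinAt ?_)
        simpa using (((hasDerivAt_id x).pow 2).add_const (C * t₀)).const_mul ε
      have hle := mul_nonpos_of_isMaxOn_Icc (y := 0) (fun z hz => heq.symm ▸ hmaxx z hz) hw hx₀
        ⟨by linarith, hd.le⟩
      have hx2 : x ^ 2 = d ^ 2 := by rcases hx with rfl | rfl <;> ring
      nlinarith [mul_pos hε (pow_pos hd 2)]
  have hx₀' : x₀ ∈ Set.Ioo (-d) d :=
    ⟨lt_of_le_of_ne hx₀.1 (hbdry _ (.inl rfl)), lt_of_le_of_ne hx₀.2 (hbdry _ (.inr rfl)).symm⟩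
  obtain ⟨a, b, c, hc, ha, hb, hcab⟩ := hpde x₀ hx₀' t₀ ht₀T
  have hloc : IsLocalMax (fun y => v y t₀ - ε * (y ^ 2 + C * t₀)) x₀ := by
    filter_upwards [Icc_mem_nhds hx₀'.1 hx₀'.2] with y hy
    rw [heq]
    exact hmaxx y hy
  have ha' : ∀ᶠ y in nhds x₀, HasDerivAt (fun z => v z t₀ - ε * (z ^ 2 + C * t₀))
      (a y - ε * (2 * y)) y := by
    filter_upwards [ha] with y hy
    refine hy.sub ?_
    simpa using (((hasDerivAt_id y).pow 2).add_const (C * t₀)).const_mul ε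
  have hax : a x₀ = ε * (2 * x₀) := by
    linarith [hloc.hasDerivAt_eq_zero ha'.self_of_nhds]
  have hbx : b ≤ 2 * ε := by
    have := hloc.second_deriv_nonpos ha' (hb.sub
      (((hasDerivAt_id x₀).const_mul 2).const_mul ε))
    linarith
  have hct : ε * C ≤ c := by
    have hw : HasDerivWithinAt (fun s => v x₀ s - ε * (x₀ ^ 2 + C * s)) (c - ε * C)
        (Set.Icc 0 t₀) t₀ := by
      refine (hc.sub ?_).hasDerivWithinAt
      simpa using (((hasDerivAt_id t₀).const_mul C).const_add (x₀ ^ 2)).const_mul ε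
    have := mul_nonpos_of_isMaxOn_Icc (y := 0) (fun z hz => heq.symm ▸ hmaxt z hz) hw
      ⟨ht₀.1.le, le_rfl⟩ ⟨le_rfl, ht₀.1.le⟩
    nlinarith [ht₀.1]
  have hκv : κ ≤ 1 - v x₀ t₀ ^ 2 := by rw [hκ]; nlinarith
  have hfirst : b / (1 - v x₀ t₀ ^ 2) ≤ 2 * ε / κ := by gcongr
  have hsecond : 2 * v x₀ t₀ * a x₀ ^ 2 / (1 - v x₀ t₀ ^ 2) ^ 2 ≤ 8 * d ^ 2 * ε / κ ^ 2 := by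
    have hnum : 2 * v x₀ t₀ * a x₀ ^ 2 ≤ 8 * d ^ 2 * ε := by
      have h₁ : a x₀ ^ 2 ≤ 4 * d ^ 2 * ε := calc
        a x₀ ^ 2 = 4 * ε * (ε * x₀ ^ 2) := by rw [hax]; ring
        _ ≤ 4 * ε * (1 * d ^ 2) := by
          gcongr 4 * ε * ?_
          exact mul_le_mul hεone (hsq x₀ hx₀) (sq_nonneg x₀) zero_le_one
        _ = 4 * d ^ 2 * ε := by ring
      have h₂ : v x₀ t₀ ≤ 1 := by linarith
      linarith [mul_le_mul_of_nonneg_right h₂ (sq_nonneg (a x₀))]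
    gcongr
  have hCε : ε * C = 2 * ε / κ + 8 * d ^ 2 * ε / κ ^ 2 + ε := by rw [hC]; ring
  linarith

/-- The derivative of `f` within `s` in the fixed direction `e`. -/
noncomputable def dirDerivWithin (s : Set (ℝ × ℝ)) (e : ℝ × ℝ) (f : ℝ × ℝ → ℝ) (p : ℝ × ℝ) : ℝ :=
  fderivWithin ℝ f s p e

theorem ContDiffOn.dirDerivWithin {s : Set (ℝ × ℝ)} {f : ℝ × ℝ → ℝ}
    (hf : ContDiffOn ℝ (⊤ : ℕ∞) f s) (hs : UniqueDiffOn ℝ s) (e : ℝ × ℝ) :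
    ContDiffOn ℝ (⊤ : ℕ∞) (dirDerivWithin s e f) s :=
  (hf.fderivWithin hs (by norm_cast)).clm_apply contDiffOn_const

theorem ContDiffOn.hasDerivWithinAt_fst {I J : Set ℝ} {f : ℝ × ℝ → ℝ}
    (hf : ContDiffOn ℝ (⊤ : ℕ∞) f (I ×ˢ J)) {x t : ℝ} (hx : x ∈ I) (ht : t ∈ J) :
    HasDerivWithinAt (fun y => f (y, t)) (_root_.dirDerivWithin (I ×ˢ J) (1, 0) f (x, t)) I x :=
  (hf.differentiableOn (by simp) (x, t) ⟨hx, ht⟩).hasFDerivWithinAt.comp_hasDerivWithinAt x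
    ((hasDerivWithinAt_id x I).prodMk (hasDerivWithinAt_const x I t))
    fun _ hy => Set.mk_mem_prod hy ht

theorem ContDiffOn.hasDerivWithinAt_snd {I J : Set ℝ} {f : ℝ × ℝ → ℝ}
    (hf : ContDiffOn ℝ (⊤ : ℕ∞) f (I ×ˢ J)) {x t : ℝ} (hx : x ∈ I) (ht : t ∈ J) :
    HasDerivWithinAt (fun s => f (x, s)) (_root_.dirDerivWithin (I ×ˢ J) (0, 1) f (x, t)) J t :=
  (hf.differentiableOn (by simp) (x, t) ⟨hx, ht⟩).hasFDerivWithinAt.comp_hasDerivWithinAt t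
    ((hasDerivWithinAt_const t J x).prodMk (hasDerivWithinAt_id t J))
    fun _ hs => Set.mk_mem_prod hx hs

theorem dirDerivWithin_comm {s : Set (ℝ × ℝ)} {f : ℝ × ℝ → ℝ}
    (hf : ContDiffOn ℝ (⊤ : ℕ∞) f s) (hs : UniqueDiffOn ℝ s) {p : ℝ × ℝ} (hp : p ∈ s)
    (hp' : p ∈ closure (interior s)) (e e' : ℝ × ℝ) :
    dirDerivWithin s e (dirDerivWithin s e' f) p =
      dirDerivWithin s e' (dirDerivWithin s e f) p := by
  have hdiff : DifferentiableWithinAt ℝ (fderivWithin ℝ f s) s p :=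
    (hf.fderivWithin hs (m := (⊤ : ℕ∞)) (by norm_cast)).differentiableOn (by simp) p hp
  have hsymm := (hf p hp).isSymmSndFDerivWithinAt (by
    rw [minSmoothness_of_isRCLikeNormedField]
    exact WithTop.coe_le_coe.2 le_top) hs hp' hp
  have key : ∀ v w, dirDerivWithin s v (dirDerivWithin s w f) p =
      fderivWithin ℝ (fderivWithin ℝ f s) s p v w := fun v w => by
    change fderivWithin ℝ (fun q => fderivWithin ℝ f s q w) s p v = _
    rw [fderivWithin_clm_apply (hs p hp) hdiff (differentiableWithinAt_const w)]
    simp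
  rw [key, key, hsymm]

/-- A weak inequality between continuous functions extends from an open interval to its closure. -/
theorem le_on_Icc_of_le_on_Ioo {f g : ℝ → ℝ} {a b : ℝ} (hab : a < b)
    (hf : ContinuousOn f (Set.Icc a b)) (hg : ContinuousOn g (Set.Icc a b))
    (h : ∀ x ∈ Set.Ioo a b, f x ≤ g x) : ∀ x ∈ Set.Icc a b, f x ≤ g x := by
  intro x hx
  have hcl : x ∈ closure (Set.Ioo a b) := by rwa [closure_Ioo hab.ne]
  exact ContinuousWithinAt.closure_le hcl ((hf x hx).mono Set.Ioo_subset_Icc_self)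
    ((hg x hx).mono Set.Ioo_subset_Icc_self) h

/-- Two functions which agree on an open interval agree at a point of its closure where both
are continuous from inside. -/
theorem eq_of_eq_on_Ioo {f g : ℝ → ℝ} {a b x : ℝ} (hab : a < b) (hx : x ∈ Set.Icc a b)
    (hf : ContinuousWithinAt f (Set.Ioo a b) x) (hg : ContinuousWithinAt g (Set.Ioo a b) x)
    (h : ∀ y ∈ Set.Ioo a b, f y = g y) : f x = g x := by
  have hcl : x ∈ closure (Set.Ioo a b) := by rwa [closure_Ioo hab.ne]
  exact le_antisymm (ContinuousWithinAt.closure_le hcl hf hg fun y hy => (h y hy).le)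
    (ContinuousWithinAt.closure_le hcl hg hf fun y hy => (h y hy).ge)

/-- The structural facts on the slope `v = u_x`, extended continuously to the closed rectangle.
The alternative at the lateral boundary reflects that `ux` and `uxx` are two-sided derivatives of a
function which is only controlled on the rectangle. -/
theorem exists_slope {d T : ℝ} (hd : 0 < d) (hT : 0 < T) {u : ℝ → ℝ → ℝ}
    (hsmooth : ContDiffOn ℝ (⊤ : ℕ∞) (fun p : ℝ × ℝ => u p.1 p.2)
      (Set.Icc (-d) d ×ˢ Set.Icc 0 T))
    (hspace : ∀ x ∈ Set.Icc (-d) d, ∀ t ∈ Set.Icc (0 : ℝ) T, |ux u x t| < 1)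
    (hpde : ∀ x ∈ Set.Icc (-d) d, ∀ t ∈ Set.Icc (0 : ℝ) T,
      ut u x t = uxx u x t / (1 - (ux u x t) ^ 2)) :
    ∃ v : ℝ → ℝ → ℝ,
      ContinuousOn (fun p : ℝ × ℝ => v p.1 p.2) (Set.Icc (-d) d ×ˢ Set.Icc 0 T) ∧
      (∀ x ∈ Set.Ioo (-d) d, ∀ t ∈ Set.Icc 0 T, ux u x t = v x t) ∧
      (∀ x ∈ Set.Ioo (-d) d, ∀ t ∈ Set.Ioo 0 T, ∃ (a : ℝ → ℝ) (b c : ℝ),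
        HasDerivAt (fun s => v x s) c t ∧
        (∀ᶠ y in nhds x, HasDerivAt (fun z => v z t) (a y) y) ∧ HasDerivAt a b x ∧
        c = b / (1 - v x t ^ 2) + 2 * v x t * a x ^ 2 / (1 - v x t ^ 2) ^ 2) ∧
      ∀ x, x = -d ∨ x = d → ∀ t ∈ Set.Ioo 0 T, v x t = ux u x t ∨
        HasDerivWithinAt (fun y => v y t) 0 (Set.Icc (-d) d) x := by
  have hdd : -d < d := by linarith
  set R := Set.Icc (-d) d ×ˢ Set.Icc (0 : ℝ) T with hR
  set F : ℝ × ℝ → ℝ := fun p => u p.1 p.2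
  have hRu : UniqueDiffOn ℝ R := (uniqueDiffOn_Icc hdd).prod (uniqueDiffOn_Icc hT)
  set V := dirDerivWithin R (1, 0) F with hV
  set Q := dirDerivWithin R (0, 1) F with hQ
  set A := dirDerivWithin R (1, 0) V with hA
  have hVs : ContDiffOn ℝ (⊤ : ℕ∞) V R := hsmooth.dirDerivWithin hRu _
  have hQs : ContDiffOn ℝ (⊤ : ℕ∞) Q R := hsmooth.dirDerivWithin hRu _
  have hAs : ContDiffOn ℝ (⊤ : ℕ∞) A R := hVs.dirDerivWithin hRu _
  have hux : ∀ x ∈ Set.Ioo (-d) d, ∀ t ∈ Set.Icc 0 T, ux u x t = V (x, t) := fun x hx t ht =>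
    ((hsmooth.hasDerivWithinAt_fst (Set.Ioo_subset_Icc_self hx) ht).hasDerivAt
      (Icc_mem_nhds hx.1 hx.2)).deriv
  have hut : ∀ x ∈ Set.Icc (-d) d, ∀ t ∈ Set.Ioo 0 T, ut u x t = Q (x, t) := fun x hx t ht =>
    ((hsmooth.hasDerivWithinAt_snd hx (Set.Ioo_subset_Icc_self ht)).hasDerivAt
      (Icc_mem_nhds ht.1 ht.2)).deriv
  have hVx : ∀ x ∈ Set.Ioo (-d) d, ∀ t ∈ Set.Icc 0 T,
      HasDerivAt (fun y => V (y, t)) (A (x, t)) x := fun x hx t ht =>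
    (hVs.hasDerivWithinAt_fst (Set.Ioo_subset_Icc_self hx) ht).hasDerivAt
      (Icc_mem_nhds hx.1 hx.2)
  have huxx : ∀ x ∈ Set.Ioo (-d) d, ∀ t ∈ Set.Icc 0 T, uxx u x t = A (x, t) := by
    intro x hx t ht
    have hev : (fun y => ux u y t) =ᶠ[nhds x] fun y => V (y, t) := by
      filter_upwards [Ioo_mem_nhds hx.1 hx.2] with y hy using hux y hy t ht
    exact hev.deriv_eq.trans (hVx x hx t ht).deriv
  have hV₁ : ∀ x ∈ Set.Ioo (-d) d, ∀ t ∈ Set.Icc 0 T, 0 < 1 - V (x, t) ^ 2 := by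
    intro x hx t ht
    have := hspace x (Set.Ioo_subset_Icc_self hx) t ht
    rw [hux x hx t ht] at this
    linarith [(sq_lt_one_iff_abs_lt_one _).2 this]
  have hQeq : ∀ x ∈ Set.Ioo (-d) d, ∀ t ∈ Set.Ioo 0 T,
      Q (x, t) = A (x, t) / (1 - V (x, t) ^ 2) := by
    intro x hx t ht
    have ht' := Set.Ioo_subset_Icc_self ht
    rw [← hut x (Set.Ioo_subset_Icc_self hx) t ht, ← huxx x hx t ht', ← hux x hx t ht']
    exact hpde x (Set.Ioo_subset_Icc_self hx) t ht'
  have hslice : ∀ G : ℝ × ℝ → ℝ, ContDiffOn ℝ (⊤ : ℕ∞) G R → ∀ t ∈ Set.Icc 0 T,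
      ∀ x ∈ Set.Icc (-d) d, ContinuousWithinAt (fun y => G (y, t)) (Set.Ioo (-d) d) x :=
    fun G hG t ht x hx =>
      (hG.hasDerivWithinAt_fst hx ht).continuousWithinAt.mono Set.Ioo_subset_Icc_self
  refine ⟨fun x t => V (x, t), hVs.continuousOn, hux, ?_, ?_⟩
  · intro x hx t ht
    have hxI := Set.Ioo_subset_Icc_self hx
    have htI := Set.Ioo_subset_Icc_self ht
    have hpR : (x, t) ∈ R := ⟨hxI, htI⟩
    have hpint : (x, t) ∈ interior R := by
      rw [hR, interior_prod_eq, interior_Icc, interior_Icc]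
      exact ⟨hx, ht⟩
    have hAx := (hAs.hasDerivWithinAt_fst hxI htI).hasDerivAt (Icc_mem_nhds hx.1 hx.2)
    have hQx := (hQs.hasDerivWithinAt_fst hxI htI).hasDerivAt (Icc_mem_nhds hx.1 hx.2)
    have hVt := (hVs.hasDerivWithinAt_snd hxI htI).hasDerivAt (Icc_mem_nhds ht.1 ht.2)
    have hne := (hV₁ x hx t htI).ne'
    refine ⟨fun y => A (y, t), _, _, hVt, ?_, hAx, ?_⟩
    · filter_upwards [Ioo_mem_nhds hx.1 hx.2] with y hy using hVx y hy t htI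
    · have hev : (fun y => Q (y, t)) =ᶠ[nhds x] fun y => A (y, t) / (1 - V (y, t) ^ 2) := by
        filter_upwards [Ioo_mem_nhds hx.1 hx.2] with y hy using hQeq y hy t ht
      have hquot := (hAx.div (((hVx x hx t htI).pow 2).const_sub 1) hne).congr_of_eventuallyEq hev
      have hcomm := dirDerivWithin_comm hsmooth hRu hpR (subset_closure hpint) (0, 1) (1, 0)
      rw [← hV, ← hQ] at hcomm
      change _root_.dirDerivWithin R (0, 1) V (x, t) = _
      rw [hcomm, hQx.unique hquot]
      simp only [Pi.pow_apply]
      field_simp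
      ring
  · intro x hxe t ht
    have htI := Set.Ioo_subset_Icc_self ht
    have hx : x ∈ Set.Icc (-d) d := by
      rcases hxe with rfl | rfl
      exacts [⟨le_rfl, hdd.le⟩, ⟨hdd.le, le_rfl⟩]
    by_cases hc : ContinuousAt (fun y => ux u y t) x
    · exact .inl (eq_of_eq_on_Ioo hdd hx (hslice V hVs t htI x hx) hc.continuousWithinAt
        fun y hy => (hux y hy t htI).symm)
    · right
      have hQ₀ : Q (x, t) = 0 := by
        have huxx₀ : uxx u x t = 0 :=
          deriv_zero_of_not_differentiableAt fun h => hc h.continuousAt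
        rw [← hut x hx t ht, hpde x hx t htI, huxx₀, zero_div]
      have hA₀ : A (x, t) = Q (x, t) * (1 - V (x, t) ^ 2) :=
        eq_of_eq_on_Ioo (f := fun y => A (y, t)) (g := fun y => Q (y, t) * (1 - V (y, t) ^ 2))
          hdd hx (hslice A hAs t htI x hx) ((hslice Q hQs t htI x hx).mul
            (continuousWithinAt_const.sub ((hslice V hVs t htI x hx).pow 2)))
          fun y hy => by rw [hQeq y hy t ht, div_mul_cancel₀ _ (hV₁ y hy t htI).ne']
      have := hVs.hasDerivWithinAt_fst hx htI
      rwa [← hA, hA₀, hQ₀, zero_mul] at this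

theorem stmt_3 (d θm θp T : ℝ) (hd : 0 < d) (hT : 0 < T)
    (hθm : θm ∈ Set.Ioo (-1 : ℝ) 1) (hθp : θp ∈ Set.Ioo (-1 : ℝ) 1)
    (u : ℝ → ℝ → ℝ)
    (hsmooth : ContDiffOn ℝ (⊤ : ℕ∞) (fun p : ℝ × ℝ => u p.1 p.2) (Set.Icc (-d) d ×ˢ Set.Icc 0 T))
    (hspace : ∀ x ∈ Set.Icc (-d) d, ∀ t ∈ Set.Icc (0 : ℝ) T, |ux u x t| < 1)
    (hpde : ∀ x ∈ Set.Icc (-d) d, ∀ t ∈ Set.Icc (0 : ℝ) T,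
      ut u x t = uxx u x t / (1 - (ux u x t) ^ 2))
    (hbcm : ∀ t ∈ Set.Icc (0 : ℝ) T, ux u (-d) t = θm)
    (hbcp : ∀ t ∈ Set.Icc (0 : ℝ) T, ux u d t = θp)
    (hinit : sSup ((fun y => |ux u y 0|) '' Set.Icc (-d) d) < 1) :
    ∀ x ∈ Set.Icc (-d) d, ∀ t ∈ Set.Icc (0 : ℝ) T,
      |ux u x t| ≤ sSup ((fun y => |ux u y 0|) '' Set.Icc (-d) d) ∧
        sSup ((fun y => |ux u y 0|) '' Set.Icc (-d) d) < 1 := by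
  set M := sSup ((fun y => |ux u y 0|) '' Set.Icc (-d) d) with hM
  have h0T : (0 : ℝ) ∈ Set.Icc 0 T := ⟨le_rfl, hT.le⟩
  have hdd : -d < d := by linarith
  have hleM : ∀ x ∈ Set.Icc (-d) d, |ux u x 0| ≤ M := fun x hx =>
    le_csSup ⟨1, by rintro _ ⟨y, hy, rfl⟩; exact (hspace y hy 0 h0T).le⟩ ⟨x, hx, rfl⟩
  have hM₀ : 0 ≤ M := (abs_nonneg _).trans (hleM d ⟨hdd.le, le_rfl⟩)
  have hbc : ∀ x, x = -d ∨ x = d → ∀ t ∈ Set.Icc 0 T, |ux u x t| ≤ M := by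
    rintro x (rfl | rfl) t ht
    · rw [hbcm t ht, ← hbcm 0 h0T]
      exact hleM _ ⟨le_rfl, hdd.le⟩
    · rw [hbcp t ht, ← hbcp 0 h0T]
      exact hleM _ ⟨hdd.le, le_rfl⟩
  obtain ⟨v, hv, hvux, hvpde, hvbc⟩ := exists_slope hd hT hsmooth hspace hpde
  have hx0 : ContinuousOn (fun x => v x 0) (Set.Icc (-d) d) :=
    hv.comp (f := fun x : ℝ => (x, (0 : ℝ))) (by fun_prop) fun x hx => ⟨hx, h0T⟩
  have hv0 : ∀ x ∈ Set.Icc (-d) d, |v x 0| ≤ M :=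
    le_on_Icc_of_le_on_Ioo hdd hx0.abs continuousOn_const fun x hx => by
      rw [← hvux x hx 0 h0T]
      exact hleM x (Set.Ioo_subset_Icc_self hx)
  have hupper : ∀ x ∈ Set.Icc (-d) d, ∀ t ∈ Set.Ico 0 T, v x t ≤ M :=
    slope_le_of_initial_le hd hM₀ hinit hv (fun x hx => (abs_le.1 (hv0 x hx)).2) hvpde
      fun x hx t ht => (hvbc x hx t ht).imp_left fun h =>
        h.trans_le (abs_le.1 (hbc x hx t (Set.Ioo_subset_Icc_self ht))).2
  have hlower : ∀ x ∈ Set.Icc (-d) d, ∀ t ∈ Set.Ico 0 T, -v x t ≤ M := by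
    refine slope_le_of_initial_le (v := fun x t => -v x t) hd hM₀ hinit hv.neg
      (fun x hx => neg_le.1 (abs_le.1 (hv0 x hx)).1) ?_ ?_
    · intro x hx t ht
      obtain ⟨a, b, c, hc, ha, hb, h⟩ := hvpde x hx t ht
      refine ⟨fun y => -a y, -b, -c, hc.neg, ha.mono fun y hy => hy.neg, hb.neg, ?_⟩
      rw [h]
      ring
    · intro x hx t ht
      refine (hvbc x hx t ht).imp (fun h => ?_) fun h => neg_zero (G := ℝ) ▸ h.fun_neg
      rw [h]
      exact neg_le.1 (abs_le.1 (hbc x hx t (Set.Ioo_subset_Icc_self ht))).1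
  intro x hx t ht
  refine ⟨?_, hinit⟩
  by_cases hxb : x = -d ∨ x = d
  · exact hbc x hxb t ht
  · push Not at hxb
    have hx' : x ∈ Set.Ioo (-d) d := ⟨hx.1.lt_of_ne' hxb.1, hx.2.lt_of_ne hxb.2⟩
    have hxt : ContinuousOn (fun t => v x t) (Set.Icc 0 T) :=
      hv.comp (f := fun t : ℝ => (x, t)) (by fun_prop) fun t ht => ⟨hx, ht⟩
    rw [hvux x hx' t ht]
    exact le_on_Icc_of_le_on_Ioo hT hxt.abs continuousOn_const (fun s hs => abs_le.2
      ⟨neg_le.1 (hlower x hx s ⟨hs.1.le, hs.2⟩), hupper x hx s ⟨hs.1.le, hs.2⟩⟩) t ht
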